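/- (Faà di Bruno, multi-index version.) Let φ = (φ¹,…,φ^m): U → V be a smooth map between open sets U ⊆ ℝ^n and V ⊆ ℝ^m, and let f: V → ℝ be smooth. Then for every multi-index β ∈ ℕ^n: ∂^β(f ∘ φ) = Σ_{λ ∈ Λ_{n,m}(β)} (β!/λ!) · ((∂^{Σ_α λ_α} f) ∘ φ) · Π_{α ≠ 0} (∂^α φ)^{λ_α}/(α!)^{Σ_i λ_{i,α}}, where Λ_{n,m}(β) is the (finite) set of finitely supported maps λ: {1,…,m} × (ℕ^n \ {0}) → ℕ, (i,α) ↦ λ_{i,α}, satisfying Σ_{i,α} λ_{i,α} α = β; here λ_α := (λ_{1,α},…,λ_{m,α}) ∈ ℕ^m, Σ_α λ_α ∈ ℕ^m, λ! := Π_{i,α} λ_{i,α}!, and (∂^α φ)^{λ_α} := Π_{i=1}^{m} (∂^α φ^i)^{λ_{i,α}}. -/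

import Mathlib

noncomputable section

/-- The first-order partial derivative `∂f/∂xᵢ`. -/
def pd {n : ℕ} (i : Fin n) (f : (Fin n → ℝ) → ℝ) : (Fin n → ℝ) → ℝ :=
  fun x => fderiv ℝ f x (Pi.single i 1)

/-- The iterated partial derivative `(∂/∂xᵢ)^k`. -/
def pdIter {n : ℕ} (i : Fin n) : ℕ → ((Fin n → ℝ) → ℝ) → ((Fin n → ℝ) → ℝ)
  | 0, f => f
  | k+1, f => pd i (pdIter i k f)

/-- The partial derivative `∂^α` for a multi-index `α ∈ ℕ^n`. -/
def mpd {n : ℕ} (α : Fin n → ℕ) (f : (Fin n → ℝ) → ℝ) : (Fin n → ℝ) → ℝ :=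
  (List.ofFn fun i : Fin n => pdIter i (α i)).foldr (fun t acc => t ∘ acc) id f

/-- The total degree `|α|` of a multi-index. -/
def mdeg {n : ℕ} (α : Fin n → ℕ) : ℕ := ∑ i, α i

/-- A jet (of infinite order) on a subset of `ℝ^n`: a family of functions indexed by
multi-indices.  (The continuity of the components on the given subset is imposed
separately.) -/
abbrev Jet (n : ℕ) := (Fin n → ℕ) → (Fin n → ℝ) → ℝ

open scoped ContDiff

section Derivatives

variable {n m : ℕ} {U : Set (Fin n → ℝ)}

lemma ContDiffOn.pd {f : (Fin n → ℝ) → ℝ} (hU : IsOpen U) (hf : ContDiffOn ℝ ∞ f U) (i : Fin n) :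
    ContDiffOn ℝ ∞ (pd i f) U :=
  (hf.fderiv_of_isOpen hU (by norm_num)).clm_apply contDiffOn_const

lemma pd_congr {f g : (Fin n → ℝ) → ℝ} (hU : IsOpen U) (h : Set.EqOn f g U) (i : Fin n) :
    Set.EqOn (pd i f) (pd i g) U := by
  intro x hx
  simp only [pd]
  rw [Filter.EventuallyEq.fderiv_eq (h.eventuallyEq_of_mem (hU.mem_nhds hx))]

lemma pd_comm {f : (Fin n → ℝ) → ℝ} (hU : IsOpen U) (hf : ContDiffOn ℝ ∞ f U) (i j : Fin n) :
    Set.EqOn (pd i (pd j f)) (pd j (pd i f)) U := by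
  intro x hx
  have hd : DifferentiableAt ℝ (fderiv ℝ f) x :=
    ((hf.fderiv_of_isOpen (m := ∞) hU (by norm_num)).contDiffAt (hU.mem_nhds hx)).differentiableAt
      (by simp)
  have key (k l : Fin n) : pd k (pd l f) x
      = fderiv ℝ (fderiv ℝ f) x (Pi.single k 1) (Pi.single l 1) := by
    have h := fderiv_clm_apply hd (differentiableAt_const (Pi.single l (1 : ℝ)))
    unfold pd
    simp [h]
  rw [key, key]
  refine ((hf.contDiffAt (hU.mem_nhds hx)).isSymmSndFDerivAt ?_).eq _ _
  simpa using WithTop.coe_le_coe.2 (le_top : (2 : ℕ∞) ≤ ⊤)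

lemma ContDiffOn.pdIter {f : (Fin n → ℝ) → ℝ} (hU : IsOpen U) (hf : ContDiffOn ℝ ∞ f U)
    (i : Fin n) (k : ℕ) : ContDiffOn ℝ ∞ (pdIter i k f) U := by
  induction k with
  | zero => exact hf
  | succ k ih => exact ih.pd hU i

lemma pdIter_congr {f g : (Fin n → ℝ) → ℝ} (hU : IsOpen U) (h : Set.EqOn f g U) (i : Fin n)
    (k : ℕ) : Set.EqOn (pdIter i k f) (pdIter i k g) U := by
  induction k with
  | zero => exact h
  | succ k ih => exact pd_congr hU ih i

lemma pdIter_pd_comm {f : (Fin n → ℝ) → ℝ} (hU : IsOpen U) (hf : ContDiffOn ℝ ∞ f U)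
    (i j : Fin n) (k : ℕ) : Set.EqOn (pdIter i k (pd j f)) (pd j (pdIter i k f)) U := by
  induction k with
  | zero => exact fun _ _ => rfl
  | succ k ih =>
    exact (pd_congr hU ih i).trans (pd_comm hU (hf.pdIter hU i k) i j)

/-- The iterated derivative `∂^α` restricted to the directions in a list. -/
def listPd (α : Fin n → ℕ) (l : List (Fin n)) (f : (Fin n → ℝ) → ℝ) : (Fin n → ℝ) → ℝ :=
  l.foldr (fun i g => pdIter i (α i) g) f

lemma mpd_eq_listPd (α : Fin n → ℕ) (f : (Fin n → ℝ) → ℝ) :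
    mpd α f = listPd α (List.finRange n) f := by
  rw [mpd, List.ofFn_eq_map, listPd]
  induction List.finRange n with
  | nil => rfl
  | cons i l ih => simp [ih]

lemma ContDiffOn.listPd {f : (Fin n → ℝ) → ℝ} (hU : IsOpen U) (hf : ContDiffOn ℝ ∞ f U)
    (α : Fin n → ℕ) (l : List (Fin n)) : ContDiffOn ℝ ∞ (listPd α l f) U := by
  induction l with
  | nil => exact hf
  | cons i l ih => exact ih.pdIter hU i _

lemma listPd_congr {f g : (Fin n → ℝ) → ℝ} (hU : IsOpen U) (h : Set.EqOn f g U)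
    (α : Fin n → ℕ) (l : List (Fin n)) : Set.EqOn (listPd α l f) (listPd α l g) U := by
  induction l with
  | nil => exact h
  | cons i l ih => exact pdIter_congr hU ih i _

lemma listPd_pd_comm {f : (Fin n → ℝ) → ℝ} (hU : IsOpen U) (hf : ContDiffOn ℝ ∞ f U)
    (α : Fin n → ℕ) (l : List (Fin n)) (j : Fin n) :
    Set.EqOn (listPd α l (pd j f)) (pd j (listPd α l f)) U := by
  induction l with
  | nil => exact fun _ _ => rfl
  | cons i l ih =>
    exact (pdIter_congr hU ih i _).trans (pdIter_pd_comm hU (hf.listPd hU α l) i j _)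

lemma listPd_add_single_of_notMem (f : (Fin n → ℝ) → ℝ) (α : Fin n → ℕ) {l : List (Fin n)}
    {j : Fin n} (hj : j ∉ l) : listPd (α + Pi.single j 1) l f = listPd α l f := by
  induction l with
  | nil => rfl
  | cons i l ih =>
    simp only [List.mem_cons, not_or] at hj
    simp only [listPd, List.foldr_cons] at ih ⊢
    rw [ih hj.2]
    simp [Pi.single_eq_of_ne' hj.1]

lemma listPd_add_single {f : (Fin n → ℝ) → ℝ} (hU : IsOpen U) (hf : ContDiffOn ℝ ∞ f U)
    (α : Fin n → ℕ) {l : List (Fin n)} (hl : l.Nodup) {j : Fin n} (hj : j ∈ l) :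
    Set.EqOn (listPd (α + Pi.single j 1) l f) (listPd α l (pd j f)) U := by
  induction l with
  | nil => simp at hj
  | cons i l ih =>
    rw [List.nodup_cons] at hl
    by_cases hij : j = i
    · subst hij
      have h1 : listPd (α + Pi.single j 1) (j :: l) f = pd j (pdIter j (α j) (listPd α l f)) := by
        rw [← listPd_add_single_of_notMem f α hl.1]
        simp [listPd, pdIter]
      rw [h1]
      exact (pdIter_pd_comm hU (hf.listPd hU α l) j j _).symm.trans
        (pdIter_congr hU (listPd_pd_comm hU hf α l j).symm j _)
    · have h1 : listPd (α + Pi.single j 1) (i :: l) f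
          = pdIter i (α i) (listPd (α + Pi.single j 1) l f) := by
        simp [listPd, Pi.single_eq_of_ne' hij]
      rw [h1]
      exact pdIter_congr hU (ih hl.2 (by simpa [hij] using hj)) i _

lemma mpd_congr {f g : (Fin n → ℝ) → ℝ} (hU : IsOpen U) (h : Set.EqOn f g U) (α : Fin n → ℕ) :
    Set.EqOn (mpd α f) (mpd α g) U := by
  simpa only [mpd_eq_listPd] using listPd_congr hU h α _

lemma mpd_add_single {f : (Fin n → ℝ) → ℝ} (hU : IsOpen U) (hf : ContDiffOn ℝ ∞ f U)
    (α : Fin n → ℕ) (j : Fin n) :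
    Set.EqOn (mpd (α + Pi.single j 1) f) (mpd α (pd j f)) U := by
  simpa only [mpd_eq_listPd] using
    listPd_add_single hU hf α (List.nodup_finRange n) (List.mem_finRange j)

lemma mpd_zero (f : (Fin n → ℝ) → ℝ) : mpd 0 f = f := by
  rw [mpd_eq_listPd]
  induction List.finRange n with
  | nil => rfl
  | cons i l ih => simp_all [listPd, pdIter]

lemma pd_add {f g : (Fin n → ℝ) → ℝ} (hU : IsOpen U) (hf : ContDiffOn ℝ ∞ f U)
    (hg : ContDiffOn ℝ ∞ g U) (i : Fin n) : Set.EqOn (pd i (f + g)) (pd i f + pd i g) U := by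
  intro x hx
  have h1 := (hf.contDiffAt (hU.mem_nhds hx)).differentiableAt (by simp)
  have h2 := (hg.contDiffAt (hU.mem_nhds hx)).differentiableAt (by simp)
  simp [pd, fderiv_add h1 h2]

lemma pd_mul {f g : (Fin n → ℝ) → ℝ} (hU : IsOpen U) (hf : ContDiffOn ℝ ∞ f U)
    (hg : ContDiffOn ℝ ∞ g U) (i : Fin n) :
    Set.EqOn (pd i (f * g)) (pd i f * g + f * pd i g) U := by
  intro x hx
  have h1 := (hf.contDiffAt (hU.mem_nhds hx)).differentiableAt (by simp)
  have h2 := (hg.contDiffAt (hU.mem_nhds hx)).differentiableAt (by simp)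
  simp [pd, fderiv_mul h1 h2]
  ring

lemma pd_comp {V : Set (Fin m → ℝ)} {φ : (Fin n → ℝ) → (Fin m → ℝ)} {f : (Fin m → ℝ) → ℝ}
    (hU : IsOpen U) (hV : IsOpen V) (hφ : ContDiffOn ℝ ∞ φ U) (hφUV : Set.MapsTo φ U V)
    (hf : ContDiffOn ℝ ∞ f V) (j : Fin n) :
    Set.EqOn (pd j (fun z => f (φ z)))
      (∑ i, (pd j fun y => φ y i) * fun z => pd i f (φ z)) U := by
  intro x hx
  have h1 := (hφ.contDiffAt (hU.mem_nhds hx)).differentiableAt (by simp)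
  have h2 := (hf.contDiffAt (hV.mem_nhds (hφUV hx))).differentiableAt (by simp)
  have h3 (i : Fin m) : pd j (fun y => φ y i) x = fderiv ℝ φ x (Pi.single j 1) i := by
    rw [pd, fderiv_apply h1]
    rfl
  have h4 : pd j (fun z => f (φ z)) x
      = fderiv ℝ f (φ x) (fderiv ℝ φ x (Pi.single j 1)) := by
    have := fderiv_comp x h2 h1
    simp only [Function.comp_def] at this
    simp [pd, this]
  rw [h4]
  conv_lhs => rw [← Finset.univ_sum_single (fderiv ℝ φ x (Pi.single j 1)), map_sum]
  rw [Finset.sum_apply]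
  refine Finset.sum_congr rfl fun i _ => ?_
  rw [Pi.mul_apply, h3, pd, ← smul_eq_mul, ← map_smul, ← Pi.single_smul, smul_eq_mul, mul_one]

lemma mdeg_add (α β : Fin n → ℕ) : mdeg (α + β) = mdeg α + mdeg β := by
  simp [mdeg, Finset.sum_add_distrib]

lemma mdeg_single (j : Fin n) : mdeg (Pi.single j 1) = 1 := by
  simp [mdeg]

lemma eq_zero_or_exists_add_single (β : Fin n → ℕ) :
    β = 0 ∨ ∃ (γ : Fin n → ℕ) (j : Fin n), β = γ + Pi.single j 1 := by
  by_cases h : β = 0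
  · exact .inl h
  · obtain ⟨j, hj⟩ := Function.ne_iff.1 h
    refine .inr ⟨β - Pi.single j 1, j, ?_⟩
    ext k
    by_cases hk : k = j
    · subst hk
      simp at hj ⊢
      omega
    · simp [hk]

lemma multiindex_induction {P : (Fin n → ℕ) → Prop} (h0 : P 0)
    (hs : ∀ γ j, P γ → P (γ + Pi.single j 1)) (β : Fin n → ℕ) : P β := by
  induction h : mdeg β generalizing β with
  | zero =>
    obtain rfl | ⟨γ, j, rfl⟩ := eq_zero_or_exists_add_single β
    · exact h0
    · simp [mdeg_add, mdeg_single] at h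
  | succ k ih =>
    obtain rfl | ⟨γ, j, rfl⟩ := eq_zero_or_exists_add_single β
    · exact h0
    · exact hs γ j (ih γ (by simpa [mdeg_add, mdeg_single] using h))

lemma mpd_add {f g : (Fin n → ℝ) → ℝ} (hU : IsOpen U) (hf : ContDiffOn ℝ ∞ f U)
    (hg : ContDiffOn ℝ ∞ g U) (β : Fin n → ℕ) : Set.EqOn (mpd β (f + g)) (mpd β f + mpd β g) U := by
  induction β using multiindex_induction generalizing f g with
  | h0 => simp [mpd_zero, Set.EqOn]
  | hs γ j ih =>
    intro x hx
    rw [mpd_add_single (f := f + g) hU (hf.add hg) γ j hx, mpd_congr hU (pd_add hU hf hg j) γ hx,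
      ih (hf.pd hU j) (hg.pd hU j) hx, Pi.add_apply, Pi.add_apply,
      mpd_add_single hU hf γ j hx, mpd_add_single hU hg γ j hx]

lemma pd_zero (j : Fin n) : pd j (0 : (Fin n → ℝ) → ℝ) = 0 := by
  ext x
  simp [pd]

lemma mpd_zero_fun (β : Fin n → ℕ) : Set.EqOn (mpd β (0 : (Fin n → ℝ) → ℝ)) 0 Set.univ := by
  induction β using multiindex_induction with
  | h0 => simp [mpd_zero, Set.EqOn]
  | hs γ j ih =>
    refine (mpd_add_single (f := 0) isOpen_univ contDiffOn_const γ j).trans ?_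
    rwa [pd_zero]

lemma mpd_sum {ι : Type*} (s : Finset ι) {f : ι → (Fin n → ℝ) → ℝ} (hU : IsOpen U)
    (hf : ∀ i, ContDiffOn ℝ ∞ (f i) U) (β : Fin n → ℕ) :
    Set.EqOn (mpd β (∑ i ∈ s, f i)) (∑ i ∈ s, mpd β (f i)) U := by
  classical
  induction s using Finset.induction_on with
  | empty => simpa using (mpd_zero_fun β).mono (Set.subset_univ U)
  | insert i s hi ih =>
    intro x hx
    rw [Finset.sum_insert hi, Finset.sum_insert hi,
      mpd_add hU (hf i) (by
        simpa only [Finset.sum_fn] using ContDiffOn.sum fun i _ => hf i) β hx,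
      Pi.add_apply, Pi.add_apply, ih hx]

/-- The Taylor coefficient `∂^β f(x) / β!`. -/
def taylorCoeff (β : Fin n → ℕ) (f : (Fin n → ℝ) → ℝ) (x : Fin n → ℝ) : ℝ :=
  mpd β f x / ((∏ j, Nat.factorial (β j) : ℕ) : ℝ)

lemma prod_factorial_add_single (γ : Fin n → ℕ) (j : Fin n) :
    ∏ k, Nat.factorial ((γ + Pi.single j 1 : Fin n → ℕ) k)
      = (γ j + 1) * ∏ k, Nat.factorial (γ k) := by
  rw [← Finset.mul_prod_erase _ _ (Finset.mem_univ j),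
    ← Finset.mul_prod_erase _ (fun k => Nat.factorial (γ k)) (Finset.mem_univ j), ← mul_assoc]
  congr 1
  · simp [Nat.factorial_succ]
  · refine Finset.prod_congr rfl fun k hk => ?_
    simp [Finset.ne_of_mem_erase hk]

lemma taylorCoeff_add_single {f : (Fin n → ℝ) → ℝ} (hU : IsOpen U) (hf : ContDiffOn ℝ ∞ f U)
    (γ : Fin n → ℕ) (j : Fin n) {x : Fin n → ℝ} (hx : x ∈ U) :
    ((γ j : ℝ) + 1) * taylorCoeff (γ + Pi.single j 1) f x = taylorCoeff γ (pd j f) x := by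
  rw [taylorCoeff, taylorCoeff, mpd_add_single hU hf γ j hx, prod_factorial_add_single]
  have h : (γ j : ℝ) + 1 ≠ 0 := by positivity
  push_cast
  field_simp

lemma sum_Iic_add_single (γ : Fin n → ℕ) (j : Fin n) (F : (Fin n → ℕ) → ℝ) :
    ∑ ν ∈ Finset.Iic γ, ((ν j : ℝ) + 1) * F (ν + Pi.single j 1)
      = ∑ α ∈ Finset.Iic (γ + Pi.single j 1), (α j : ℝ) * F α := by
  refine Finset.sum_of_injOn (fun ν => ν + Pi.single j 1) (add_left_injective _).injOn
    (fun ν hν => ?_) (fun α hα h => ?_) fun ν _ => by simp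
  · simpa using hν
  · have : α j = 0 := by
      by_contra hne
      refine h ⟨α - Pi.single j 1, ?_, ?_⟩
      · simpa [tsub_le_iff_right] using hα
      · refine tsub_add_cancel_of_le fun k => ?_
        by_cases hk : k = j
        · subst hk
          simpa using Nat.one_le_iff_ne_zero.2 hne
        · simp [hk]
    simp [this]

lemma sum_Iic_reflect (β : Fin n → ℕ) (F : (Fin n → ℕ) → (Fin n → ℕ) → ℝ) :
    ∑ α ∈ Finset.Iic β, F (β - α) α = ∑ α ∈ Finset.Iic β, F α (β - α) := by
  refine Finset.sum_nbij' (fun α => β - α) (fun α => β - α) ?_ ?_ ?_ ?_ ?_ <;>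
    intro α hα <;> rw [Finset.mem_Iic] at hα <;>
    simp [tsub_tsub_cancel_of_le hα]

lemma add_single_sub_add_single (γ ν : Fin n → ℕ) (j : Fin n) :
    γ + Pi.single j 1 - (ν + Pi.single j 1) = γ - ν :=
  add_tsub_add_eq_tsub_right γ _ ν

lemma taylorCoeff_mul {f g : (Fin n → ℝ) → ℝ} (hU : IsOpen U) (hf : ContDiffOn ℝ ∞ f U)
    (hg : ContDiffOn ℝ ∞ g U) (β : Fin n → ℕ) {x : Fin n → ℝ} (hx : x ∈ U) :
    taylorCoeff β (f * g) x
      = ∑ α ∈ Finset.Iic β, taylorCoeff α f x * taylorCoeff (β - α) g x := by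
  induction β using multiindex_induction generalizing f g with
  | h0 =>
    have : Finset.Iic (0 : Fin n → ℕ) = {0} := by
      ext α
      simp
    simp [this, taylorCoeff, mpd_zero]
  | hs γ j ih =>
    have h : (γ j : ℝ) + 1 ≠ 0 := by positivity
    refine mul_left_cancel₀ h ?_
    rw [taylorCoeff_add_single (f := f * g) hU (hf.mul hg) γ j hx, taylorCoeff,
      mpd_congr hU (pd_mul hU hf hg j) γ hx,
      mpd_add (f := pd j f * g) (g := f * pd j g) hU ((hf.pd hU j).mul hg)
        (hf.mul (hg.pd hU j)) γ hx, Pi.add_apply, add_div,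
      ← taylorCoeff, ← taylorCoeff, ih (hf.pd hU j) hg, ih hf (hg.pd hU j),
      ← sum_Iic_reflect γ fun μ ν => taylorCoeff μ f x * taylorCoeff ν (pd j g) x]
    simp_rw [← taylorCoeff_add_single hU hf _ j hx, ← taylorCoeff_add_single hU hg _ j hx]
    have h1 := sum_Iic_add_single γ j
      fun α => taylorCoeff α f x * taylorCoeff (γ + Pi.single j 1 - α) g x
    have h2 := sum_Iic_add_single γ j
      fun α => taylorCoeff (γ + Pi.single j 1 - α) f x * taylorCoeff α g x
    rw [sum_Iic_reflect (γ + Pi.single j 1) fun μ ν =>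
      (ν j : ℝ) * (taylorCoeff μ f x * taylorCoeff ν g x)] at h2
    simp_rw [add_single_sub_add_single] at h1 h2
    simp_rw [mul_assoc, mul_left_comm (taylorCoeff _ f x)]
    rw [h1, h2, ← Finset.sum_add_distrib, Finset.mul_sum]
    refine Finset.sum_congr rfl fun α hα => ?_
    have hj : α j ≤ γ j + 1 := by simpa using Finset.mem_Iic.1 hα j
    rw [← add_mul]
    congr 1
    simp [Nat.cast_sub hj]

lemma taylorCoeff_comp {V : Set (Fin m → ℝ)} {φ : (Fin n → ℝ) → (Fin m → ℝ)}
    {f : (Fin m → ℝ) → ℝ} (hU : IsOpen U) (hV : IsOpen V) (hφ : ContDiffOn ℝ ∞ φ U)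
    (hφUV : Set.MapsTo φ U V) (hf : ContDiffOn ℝ ∞ f V) (γ : Fin n → ℕ) (j : Fin n)
    {x : Fin n → ℝ} (hx : x ∈ U) :
    ((γ j : ℝ) + 1) * taylorCoeff (γ + Pi.single j 1) (fun z => f (φ z)) x
      = ∑ i, ∑ α ∈ Finset.Iic (γ + Pi.single j 1), (α j : ℝ) *
          (taylorCoeff α (fun y => φ y i) x *
            taylorCoeff (γ + Pi.single j 1 - α) (fun z => pd i f (φ z)) x) := by
  have hφi (i : Fin m) : ContDiffOn ℝ ∞ (fun y => φ y i) U := contDiffOn_pi.1 hφ i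
  have hfi (i : Fin m) : ContDiffOn ℝ ∞ (fun z => pd i f (φ z)) U := (hf.pd hV i).comp hφ hφUV
  rw [taylorCoeff_add_single (f := fun z => f (φ z)) hU (hf.comp hφ hφUV) γ j hx, taylorCoeff,
    mpd_congr hU (pd_comp hU hV hφ hφUV hf j) γ hx,
    mpd_sum (f := fun i => (pd j fun y => φ y i) * fun z => pd i f (φ z)) _ hU
      (fun i => ((hφi i).pd hU j).mul (hfi i)) γ hx, Finset.sum_apply, Finset.sum_div]
  refine Finset.sum_congr rfl fun i _ => ?_
  rw [← taylorCoeff, taylorCoeff_mul hU ((hφi i).pd hU j) (hfi i) γ hx,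
    ← sum_Iic_add_single γ j]
  refine Finset.sum_congr rfl fun ν _ => ?_
  rw [add_single_sub_add_single, ← taylorCoeff_add_single hU (hφi i) ν j hx, mul_assoc]

end Derivatives

section Combinatorics

variable {n : ℕ} {S : Type*} [Fintype S]

open Classical in
/-- The functions `l : S → ℕ` with values at most `N`, vanishing on the elements of weight zero
and of total weight `β`. -/
def weightedComps (N : ℕ) (w : S → Fin n → ℕ) (β : Fin n → ℕ) : Finset (S → ℕ) :=
  (Fintype.piFinset fun _ => Finset.range (N + 1)).filter fun l =>
    (∀ s, w s = 0 → l s = 0) ∧ ∑ s, l s • w s = β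

lemma le_mdeg (β : Fin n → ℕ) (k : Fin n) : β k ≤ mdeg β :=
  Finset.single_le_sum (f := β) (fun _ _ => Nat.zero_le _) (Finset.mem_univ k)

lemma mdeg_mono {α β : Fin n → ℕ} (h : α ≤ β) : mdeg α ≤ mdeg β :=
  Finset.sum_le_sum fun k _ => h k

lemma smul_weight_le (l : S → ℕ) (w : S → Fin n → ℕ) (s : S) : l s • w s ≤ ∑ s, l s • w s :=
  Finset.single_le_sum (f := fun s => l s • w s) (fun _ _ _ => Nat.zero_le _) (Finset.mem_univ s)

lemma mem_weightedComps {N : ℕ} {w : S → Fin n → ℕ} {β : Fin n → ℕ} (hβ : mdeg β ≤ N)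
    {l : S → ℕ} :
    l ∈ weightedComps N w β ↔ (∀ s, w s = 0 → l s = 0) ∧ ∑ s, l s • w s = β := by
  classical
  simp only [weightedComps, Finset.mem_filter, Fintype.mem_piFinset, Finset.mem_range,
    and_iff_right_iff_imp]
  rintro ⟨h0, hl⟩ s
  by_cases hs : w s = 0
  · simp [h0 s hs]
  · obtain ⟨k, hk⟩ := Function.ne_iff.1 hs
    have h1 : l s * w s k ≤ β k := by
      simpa using (hl ▸ smul_weight_le l w s : l s • w s ≤ β) k
    have h2 : l s ≤ l s * w s k := Nat.le_mul_of_pos_right _ (Nat.pos_of_ne_zero hk)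
    have h3 := le_mdeg β k
    omega

lemma weightedComps_zero (N : ℕ) (w : S → Fin n → ℕ) : weightedComps N w 0 = {0} := by
  ext l
  rw [mem_weightedComps (by simp [mdeg]), Finset.mem_singleton]
  constructor
  · rintro ⟨h0, hl⟩
    ext s
    have h : l s • w s = 0 := le_antisymm (hl ▸ smul_weight_le l w s) zero_le
    obtain h | h := smul_eq_zero.1 h
    exacts [h, h0 s h]
  · rintro rfl
    simp

lemma prod_pow_div_factorial_add_single [DecidableEq S] (a : S → ℝ) (l : S → ℕ) (s : S) :
    ((l s : ℝ) + 1) * ∏ t, a t ^ (l + Pi.single s 1 : S → ℕ) t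
        / (Nat.factorial ((l + Pi.single s 1 : S → ℕ) t) : ℝ)
      = a s * ∏ t, a t ^ l t / (Nat.factorial (l t) : ℝ) := by
  rw [← Finset.mul_prod_erase _ _ (Finset.mem_univ s),
    ← Finset.mul_prod_erase _ (fun t => a t ^ l t / (Nat.factorial (l t) : ℝ))
      (Finset.mem_univ s), ← mul_assoc, ← mul_assoc]
  congr 1
  · have h : (l s : ℝ) + 1 ≠ 0 := by positivity
    simp only [Pi.add_apply, Pi.single_eq_same, Nat.factorial_succ, pow_succ]
    push_cast
    field_simp
  · refine Finset.prod_congr rfl fun t ht => ?_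
    simp [Finset.ne_of_mem_erase ht]

open Classical in
lemma sum_weightedComps_mul_apply {N : ℕ} {w : S → Fin n → ℕ} {β : Fin n → ℕ}
    (hβ : mdeg β ≤ N) (a : S → ℝ) (c : (S → ℕ) → ℝ) {s : S} (hs : w s ≠ 0) :
    ∑ l ∈ weightedComps N w β, (l s : ℝ) * ((∏ t, a t ^ l t / (Nat.factorial (l t) : ℝ)) * c l)
      = if w s ≤ β then a s * ∑ l ∈ weightedComps N w (β - w s),
          (∏ t, a t ^ l t / (Nat.factorial (l t) : ℝ)) * c (l + Pi.single s 1) else 0 := by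
  have hsum (l : S → ℕ) : ∑ t, (l + Pi.single s 1 : S → ℕ) t • w t = ∑ t, l t • w t + w s := by
    simp [add_smul, Finset.sum_add_distrib, Pi.single_apply]
  split_ifs with hw
  · have hβ' : mdeg (β - w s) ≤ N := (mdeg_mono tsub_le_self).trans hβ
    rw [Finset.mul_sum]
    symm
    refine Finset.sum_of_injOn (fun l => l + Pi.single s 1) (add_left_injective _).injOn
      (fun l hl => ?_) (fun l hl h => ?_) fun l _ => ?_
    · rw [Finset.mem_coe, mem_weightedComps hβ'] at hl
      rw [Finset.mem_coe, mem_weightedComps hβ]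
      refine ⟨fun t ht => ?_, ?_⟩
      · have : t ≠ s := fun h => hs (h ▸ ht)
        simp [hl.1 t ht, this]
      · rw [hsum, hl.2, tsub_add_cancel_of_le hw]
    · have : l s = 0 := by
        by_contra hne
        have hl' : l - Pi.single s 1 + Pi.single s 1 = l := by
          refine tsub_add_cancel_of_le fun t => ?_
          by_cases ht : t = s
          · subst ht
            simpa using Nat.one_le_iff_ne_zero.2 hne
          · simp [ht]
        refine h ⟨l - Pi.single s 1, ?_, hl'⟩
        rw [mem_weightedComps hβ] at hl
        rw [Finset.mem_coe, mem_weightedComps hβ']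
        refine ⟨fun t ht => by simp [hl.1 t ht], ?_⟩
        rw [← hl.2, ← hl', hsum, hl', add_tsub_cancel_right]
      simp [this]
    · rw [← mul_assoc, ← mul_assoc, ← prod_pow_div_factorial_add_single]
      simp
  · refine Finset.sum_eq_zero fun l hl => ?_
    rw [mem_weightedComps hβ] at hl
    have : l s = 0 := by
      by_contra hne
      refine hw (le_trans (fun k => ?_) (hl.2 ▸ smul_weight_le l w s))
      exact Nat.le_mul_of_pos_left _ (Nat.pos_of_ne_zero hne)
    simp [this]

open Classical in
lemma mul_sum_weightedComps {N : ℕ} {w : S → Fin n → ℕ} {β : Fin n → ℕ}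
    (hβ : mdeg β ≤ N) (a : S → ℝ) (c : (S → ℕ) → ℝ) (j : Fin n) :
    (β j : ℝ) * ∑ l ∈ weightedComps N w β, (∏ t, a t ^ l t / (Nat.factorial (l t) : ℝ)) * c l
      = ∑ s, if w s ≤ β then (w s j : ℝ) * (a s * ∑ l ∈ weightedComps N w (β - w s),
          (∏ t, a t ^ l t / (Nat.factorial (l t) : ℝ)) * c (l + Pi.single s 1)) else 0 := by
  have h1 : ∀ l ∈ weightedComps N w β, (β j : ℝ) = ∑ s, (w s j : ℝ) * (l s : ℝ) := by
    intro l hl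
    rw [mem_weightedComps hβ] at hl
    have := congrFun hl.2 j
    rw [← this]
    simp [Finset.sum_apply, mul_comm]
  rw [Finset.mul_sum, Finset.sum_congr rfl fun l hl => by rw [h1 l hl, Finset.sum_mul],
    Finset.sum_comm]
  refine Finset.sum_congr rfl fun s _ => ?_
  simp_rw [mul_assoc]
  rw [← Finset.mul_sum]
  by_cases hs : w s = 0
  · simp [hs]
  · rw [sum_weightedComps_mul_apply hβ a c hs, mul_ite, mul_zero]

open Classical in
lemma sum_Iic_eq_sum_fin {N : ℕ} {β : Fin n → ℕ} (hβ : mdeg β ≤ N) (F : (Fin n → ℕ) → ℝ) :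
    ∑ α ∈ Finset.Iic β, F α
      = ∑ a : Fin n → Fin (N + 1), if (fun k => (a k : ℕ)) ≤ β then F fun k => (a k : ℕ) else 0 := by
  rw [← Finset.sum_filter]
  symm
  refine Finset.sum_bij (fun a _ k => (a k : ℕ)) (fun a ha => by simpa using ha)
    (fun a _ b _ h => ?_) (fun α hα => ?_) fun _ _ => rfl
  · ext k
    exact congrFun h k
  · rw [Finset.mem_Iic] at hα
    exact ⟨fun k => ⟨α k, Nat.lt_succ_of_le (((hα k).trans (le_mdeg β k)).trans hβ)⟩,
      by simpa using hα, rfl⟩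

end Combinatorics

lemma taylorCoeff_comp_eq_sum {n m : ℕ} {U : Set (Fin n → ℝ)} {V : Set (Fin m → ℝ)}
    (hU : IsOpen U) (hV : IsOpen V) {φ : (Fin n → ℝ) → (Fin m → ℝ)} (hφ : ContDiffOn ℝ ∞ φ U)
    (hφUV : Set.MapsTo φ U V) {f : (Fin m → ℝ) → ℝ} (hf : ContDiffOn ℝ ∞ f V) {N : ℕ}
    {β : Fin n → ℕ} (hβ : mdeg β ≤ N) {x : Fin n → ℝ} (hx : x ∈ U) :
    taylorCoeff β (fun z => f (φ z)) x =
      ∑ l ∈ weightedComps N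
          (fun (s : Fin m × (Fin n → Fin (N + 1))) k => (s.2 k : ℕ)) β,
        (∏ s : Fin m × (Fin n → Fin (N + 1)),
          taylorCoeff (fun k => (s.2 k : ℕ)) (fun y => φ y s.1) x ^ l s
            / (Nat.factorial (l s) : ℝ))
          * mpd (fun i => ∑ a, l (i, a)) f (φ x) := by
  induction h : mdeg β using Nat.strong_induction_on generalizing β f with
  | _ d ih =>
  obtain rfl | ⟨γ, j, hγ⟩ := eq_zero_or_exists_add_single β
  · rw [weightedComps_zero]
    have : (fun _ : Fin m => 0) = (0 : Fin m → ℕ) := rfl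
    simp [taylorCoeff, mpd_zero, this]
  · have hj : (β j : ℝ) = (γ j : ℝ) + 1 := by simp [hγ]
    have hj0 : (β j : ℝ) ≠ 0 := by rw [hj]; positivity
    refine mul_left_cancel₀ hj0 ?_
    have hcomp := taylorCoeff_comp hU hV hφ hφUV hf γ j hx
    rw [← hγ, ← hj] at hcomp
    rw [hcomp, mul_sum_weightedComps hβ, Fintype.sum_prod_type]
    refine Finset.sum_congr rfl fun i _ => ?_
    rw [sum_Iic_eq_sum_fin hβ]
    refine Finset.sum_congr rfl fun a _ => ?_
    split_ifs with ha
    · by_cases haj : (a j : ℕ) = 0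
      · simp [haj]
      · have hlt : mdeg (β - fun k => (a k : ℕ)) < d := by
          have h1 := mdeg_add (β - fun k => (a k : ℕ)) fun k => (a k : ℕ)
          rw [tsub_add_cancel_of_le ha] at h1
          have h2 := le_mdeg (fun k => (a k : ℕ)) j
          omega
        rw [ih _ hlt (hf.pd hV i) (by omega) rfl]
        congr 2
        refine Finset.sum_congr rfl fun l _ => ?_
        rw [← mpd_add_single hV hf _ i (hφUV hx)]
        congr 2
        ext k
        by_cases hk : k = i
        · subst hk
          simp [Finset.sum_add_distrib, Pi.single_apply]
        · simp [hk]
    · rfl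

/-- Formula of Faà di Bruno, multi-index version.  The finitely supported
maps `λ : {1,…,m} × (ℕ^n \ {0}) → ℕ` with `Σ_{i,α} λ_{i,α} α = β` are encoded as functions
`Fin m → (Fin n → Fin (|β|+1)) → Fin (|β|+1)` vanishing at `α = 0` (every solution of the
constraint is supported on multi-indices `α ≤ β` and has values `≤ |β|`, so this encoding
is faithful). -/
theorem faa_di_bruno_multiindex
    {n m : ℕ} (U : Set (Fin n → ℝ)) (V : Set (Fin m → ℝ))
    (hU : IsOpen U) (hV : IsOpen V)
    (φ : (Fin n → ℝ) → (Fin m → ℝ)) (hφ : ContDiffOn ℝ (⊤ : ℕ∞) φ U)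
    (hφUV : Set.MapsTo φ U V)
    (f : (Fin m → ℝ) → ℝ) (hf : ContDiffOn ℝ (⊤ : ℕ∞) f V)
    (β : Fin n → ℕ) (x : Fin n → ℝ) (hx : x ∈ U) :
    mpd β (fun z => f (φ z)) x =
      ∑ lam : Fin m → (Fin n → Fin (mdeg β + 1)) → Fin (mdeg β + 1),
        if (∀ i a, (∀ j, (a j : ℕ) = 0) → (lam i a : ℕ) = 0)
            ∧ (∀ j : Fin n,
                (∑ i, ∑ a : Fin n → Fin (mdeg β + 1), (lam i a : ℕ) * (a j : ℕ)) = β j) then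
          ((∏ j, Nat.factorial (β j) : ℕ) : ℝ)
              / ((∏ i, ∏ a : Fin n → Fin (mdeg β + 1), Nat.factorial (lam i a) : ℕ) : ℝ)
            * mpd (fun i => ∑ a : Fin n → Fin (mdeg β + 1), (lam i a : ℕ)) f (φ x)
            * ∏ a : Fin n → Fin (mdeg β + 1),
                (∏ i, (mpd (fun j => (a j : ℕ)) (fun y => φ y i) x) ^ ((lam i a : ℕ)))
                  / ((∏ j, Nat.factorial (a j) : ℕ) : ℝ) ^ (∑ i, (lam i a : ℕ))
        else 0 := by
  have hpos : ((∏ j, Nat.factorial (β j) : ℕ) : ℝ) ≠ 0 :=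
    Nat.cast_ne_zero.2 (Finset.prod_ne_zero_iff.2 fun j _ => Nat.factorial_ne_zero _)
  have key := taylorCoeff_comp_eq_sum hU hV hφ hφUV hf (le_refl (mdeg β)) hx
  rw [taylorCoeff, div_eq_iff hpos] at key
  rw [key, Finset.sum_mul, ← Finset.sum_filter]
  symm
  refine Finset.sum_bij (fun lam _ s => (lam s.1 s.2 : ℕ)) (fun lam hlam => ?_)
    (fun lam _ lam' _ h => ?_) (fun l hl => ?_) fun lam _ => ?_
  · rw [Finset.mem_filter] at hlam
    rw [mem_weightedComps le_rfl]
    refine ⟨fun s hs => hlam.2.1 s.1 s.2 fun k => congrFun hs k, ?_⟩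
    ext k
    rw [← hlam.2.2 k, Finset.sum_apply, Fintype.sum_prod_type]
    rfl
  · ext i a
    exact congrFun h (i, a)
  · have hbound : ∀ s, l s < mdeg β + 1 := by
      simp only [weightedComps, Finset.mem_filter, Fintype.mem_piFinset] at hl
      exact fun s => Finset.mem_range.1 (hl.1 s)
    rw [mem_weightedComps le_rfl] at hl
    refine ⟨fun i a => ⟨l (i, a), hbound _⟩, ?_, rfl⟩
    rw [Finset.mem_filter]
    refine ⟨Finset.mem_univ _, fun i a h0 => hl.1 (i, a) (funext h0), fun k => ?_⟩
    have := congrFun hl.2 k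
    rw [Finset.sum_apply, Fintype.sum_prod_type] at this
    exact this
  · simp only [taylorCoeff, Fintype.prod_prod_type_right, Finset.prod_div_distrib, div_pow,
      Finset.prod_pow_eq_pow_sum, Nat.cast_prod]
    rw [Finset.prod_comm (f := fun i a => ((Nat.factorial (lam i a) : ℕ) : ℝ))]
    ring
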